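/- For all integers k ≥ 3 and s ≥ 1 there exists a k-uniform hypergraph H on k + ks vertices with maximum degree exactly (k−1)s such that for all λ ∈ ℂ, Z_H(λ) = Σ_{ℓ=0}^{k−2} binom(k,ℓ) · λ^ℓ · (1+λ)^{sk} + k · λ^{k−1} · (1+λ)^{s(k−1)} + λ^k. -/

import Mathlib

open Finset

/-- The univariate independence polynomial of the hypergraph with vertex type `V`
and edge set `E`: the sum of `x ^ |I|` over all independent sets `I`. -/
noncomputable def indepPoly {V : Type*} [Fintype V] [DecidableEq V]
    (E : Finset (Finset V)) (x : ℂ) : ℂ :=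
  ∑ I ∈ univ.powerset.filter (fun I => ∀ e ∈ E, ¬ e ⊆ I), x ^ I.card

namespace WitnessHypergraph

/-- Renaming the vertices of a hypergraph preserves its independence polynomial. -/
theorem indepPoly_map_equiv {V W : Type*} [Fintype V] [DecidableEq V] [Fintype W] [DecidableEq W]
    (f : V ≃ W) (E : Finset (Finset V)) (x : ℂ) :
    indepPoly (E.map f.finsetCongr.toEmbedding) x = indepPoly E x := by
  unfold indepPoly
  symm
  refine Finset.sum_equiv f.finsetCongr (fun I => ?_) (fun I _ => ?_)
  · simp only [powerset_univ, mem_filter, mem_univ, true_and, mem_map, forall_exists_index, and_imp,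
      forall_apply_eq_imp_iff₂, Equiv.coe_toEmbedding, Equiv.finsetCongr_apply, map_subset_map]
  · simp

theorem card_filter_mem_map_equiv {V W : Type*} [DecidableEq V] [DecidableEq W]
    (f : V ≃ W) (E : Finset (Finset V)) (w : W) :
    ((E.map f.finsetCongr.toEmbedding).filter (fun e => w ∈ e)).card =
      (E.filter (fun e => f.symm w ∈ e)).card := by
  rw [Finset.filter_map, Finset.card_map]
  congr 1
  ext e
  simp

/-- The edge consisting of all core vertices but `p.1`, together with the cloud vertex `p`. -/
def edge {k s : ℕ} (p : Fin k × Fin s) : Finset (Fin k ⊕ (Fin k × Fin s)) :=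
  (univ.erase p.1).disjSum {p}

theorem edge_injective {k s : ℕ} : Function.Injective (edge (k := k) (s := s)) := by
  intro p q h
  have hp : Sum.inr p ∈ edge q := h ▸ by simp [edge]
  simpa [edge] using hp

theorem card_edge {k s : ℕ} (p : Fin k × Fin s) : (edge p).card = k := by
  have := p.1.pos
  simp only [edge, card_disjSum, card_erase_of_mem (mem_univ _), card_univ, Fintype.card_fin,
    card_singleton]
  omega

/-- The edge set of the witnessing hypergraph with `k` core vertices and clouds of size `s`. -/
def edges (k s : ℕ) : Finset (Finset (Fin k ⊕ (Fin k × Fin s))) :=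
  univ.map ⟨edge, edge_injective⟩

theorem degree_eq (k s : ℕ) (v : Fin k ⊕ (Fin k × Fin s)) :
    ((edges k s).filter (fun e => v ∈ e)).card =
      (univ.filter (fun p : Fin k × Fin s => v ∈ edge p)).card := by
  rw [edges, Finset.filter_map, Finset.card_map]
  rfl

theorem degree_core (k s : ℕ) (i : Fin k) :
    ((edges k s).filter (fun e => Sum.inl i ∈ e)).card = (k - 1) * s := by
  have h : univ.filter (fun p : Fin k × Fin s => Sum.inl i ∈ edge p) =
      univ.erase i ×ˢ univ := by
    ext p
    simp [edge, eq_comm]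
  rw [degree_eq, h]
  simp

theorem degree_cloud (k s : ℕ) (q : Fin k × Fin s) :
    ((edges k s).filter (fun e => Sum.inr q ∈ e)).card = 1 := by
  rw [degree_eq, Finset.card_eq_one]
  exact ⟨q, by ext p; simp [edge, eq_comm]⟩

theorem indepPoly_edges_eq_sum (k s : ℕ) (x : ℂ) :
    indepPoly (edges k s) x = ∑ S : Finset (Fin k), x ^ S.card *
      (1 + x) ^ ((univ.filter fun i : Fin k => ¬ univ.erase i ⊆ S).card * s) := by
  have hfree (S : Finset (Fin k)) :
      (univ.filter fun i : Fin k => ¬ univ.erase i ⊆ S).card * s =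
        ((univ.filter fun i : Fin k => ¬ univ.erase i ⊆ S) ×ˢ (univ : Finset (Fin s))).card := by
    simp
  have hpow (A : Finset (Fin k × Fin s)) :
      (1 + x) ^ A.card = ∑ T ∈ A.powerset, x ^ T.card := by
    simpa [add_comm] using (Finset.sum_pow_mul_eq_add_pow x 1 A).symm
  simp_rw [hfree, hpow, Finset.mul_sum, Finset.sum_sigma', indepPoly]
  refine Finset.sum_bij' (fun I _ => ⟨I.toLeft, I.toRight⟩) (fun q _ => q.1.disjSum q.2)
    ?_ ?_ ?_ ?_ ?_
  · intro I hI
    simp only [mem_filter, edges, mem_map, mem_univ, true_and, Function.Embedding.coeFn_mk,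
      forall_exists_index, forall_apply_eq_imp_iff] at hI
    simp only [mem_sigma, mem_univ, true_and, mem_powerset]
    intro p hp
    simp only [mem_product, mem_filter, mem_univ, true_and, and_true]
    intro hsub
    refine hI.2 p ?_
    rw [edge, Finset.disjSum_subset]
    exact ⟨hsub, by simpa using hp⟩
  · rintro ⟨S, T⟩ h
    simp only [mem_sigma, mem_univ, true_and, mem_powerset] at h
    simp only [mem_filter, edges, mem_map, mem_univ, true_and, Function.Embedding.coeFn_mk,
      forall_exists_index, forall_apply_eq_imp_iff, powerset_univ]
    intro p hp
    rw [edge, Finset.disjSum_subset] at hp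
    simp only [toLeft_disjSum, toRight_disjSum, singleton_subset_iff] at hp
    have := h hp.2
    simp only [mem_product, mem_filter, mem_univ, true_and, and_true] at this
    exact this hp.1
  · intro I _
    exact Finset.toLeft_disjSum_toRight
  · rintro ⟨S, T⟩ _
    simp
  · intro I _
    rw [← pow_add, Finset.card_toLeft_add_card_toRight]

theorem card_filter_erase_not_subset {k : ℕ} (S : Finset (Fin k)) :
    (univ.filter fun i : Fin k => ¬ univ.erase i ⊆ S).card =
      if S.card = k then 0 else if S.card + 1 = k then k - 1 else k := by
  have hiff (i : Fin k) : univ.erase i ⊆ S ↔ Sᶜ ⊆ {i} := by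
    rw [← compl_singleton]
    exact compl_le_iff_compl_le
  have hcard : S.card + Sᶜ.card = k := by
    simp
  simp_rw [hiff]
  split_ifs with h₀ h₁
  · have : Sᶜ = ∅ := by rw [← card_eq_zero]; omega
    simp [this]
  · obtain ⟨a, ha⟩ := card_eq_one.mp (show Sᶜ.card = 1 by omega)
    simp [ha, Finset.filter_not, Finset.filter_eq, card_sdiff]
  · rw [filter_true_of_mem, card_univ, Fintype.card_fin]
    intro i _ hi
    have := card_le_card hi
    rw [card_singleton] at this
    omega

theorem indepPoly_edges (k s : ℕ) (hk : 1 ≤ k) (x : ℂ) :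
    indepPoly (edges k s) x =
      (∑ l ∈ range (k - 1), (k.choose l : ℂ) * x ^ l * (1 + x) ^ (s * k)) +
        (k : ℂ) * x ^ (k - 1) * (1 + x) ^ (s * (k - 1)) + x ^ k := by
  obtain ⟨n, rfl⟩ := Nat.exists_eq_add_of_le' hk
  simp_rw [indepPoly_edges_eq_sum, card_filter_erase_not_subset]
  rw [← powerset_univ, Finset.sum_powerset_apply_card (fun m => x ^ m *
    (1 + x) ^ ((if m = n + 1 then 0 else if m + 1 = n + 1 then n + 1 - 1 else n + 1) * s)),
    card_univ, Fintype.card_fin, Finset.sum_range_succ, Finset.sum_range_succ]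
  have hlow : ∀ l ∈ range n, (n + 1).choose l • (x ^ l *
      (1 + x) ^ ((if l = n + 1 then 0 else if l + 1 = n + 1 then n + 1 - 1 else n + 1) * s)) =
      ((n + 1).choose l : ℂ) * x ^ l * (1 + x) ^ (s * (n + 1)) := by
    intro l hl
    rw [mem_range] at hl
    rw [if_neg (by omega), if_neg (by omega), nsmul_eq_mul, mul_assoc, mul_comm s]
  rw [Finset.sum_congr rfl hlow]
  simp [mul_comm s, mul_assoc]

end WitnessHypergraph

/-- For all `k ≥ 3`, `s ≥ 1` there is a `k`-uniform hypergraph on `k + ks` vertices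
with maximum degree exactly `(k−1)s` whose independence polynomial is
`Σ_{ℓ=0}^{k−2} C(k,ℓ) λ^ℓ (1+λ)^{sk} + k λ^{k−1} (1+λ)^{s(k−1)} + λ^k`. -/
theorem samotij_hypergraph_exists
    (k s : ℕ) (hk : 3 ≤ k) (hs : 1 ≤ s) :
    ∃ E : Finset (Finset (Fin (k + k * s))),
      (∀ e ∈ E, e.card = k) ∧
      (∀ v : Fin (k + k * s), (E.filter (fun e => v ∈ e)).card ≤ (k - 1) * s) ∧
      (∃ v : Fin (k + k * s), (E.filter (fun e => v ∈ e)).card = (k - 1) * s) ∧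
      ∀ lam : ℂ,
        indepPoly E lam =
          (∑ l ∈ Finset.range (k - 1),
              (k.choose l : ℂ) * lam ^ l * (1 + lam) ^ (s * k)) +
            (k : ℂ) * lam ^ (k - 1) * (1 + lam) ^ (s * (k - 1)) + lam ^ k := by
  open WitnessHypergraph in
  let f : Fin k ⊕ (Fin k × Fin s) ≃ Fin (k + k * s) :=
    (Equiv.sumCongr (Equiv.refl _) finProdFinEquiv).trans finSumFinEquiv
  refine ⟨(edges k s).map f.finsetCongr.toEmbedding, ?_, fun v => ?_,
    ⟨f (Sum.inl ⟨0, by omega⟩), ?_⟩, fun lam => ?_⟩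
  · intro e he
    simp only [edges, mem_map, mem_univ, true_and, Function.Embedding.coeFn_mk] at he
    obtain ⟨_, ⟨p, rfl⟩, rfl⟩ := he
    simpa using card_edge p
  · rw [card_filter_mem_map_equiv]
    rcases f.symm v with i | q
    · exact (degree_core k s i).le
    · rw [degree_cloud]
      exact Nat.mul_pos (by omega) hs
  · rw [card_filter_mem_map_equiv, f.symm_apply_apply, degree_core]
  · rw [indepPoly_map_equiv, indepPoly_edges k s (by omega)]
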